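/- Sequent interpolation: if Γ ⇒ Δ is derivable in GT, then for every pair of partitions Γ = Γ₁,Γ₂ and Δ = Λ₁,Δ₂ where Λ₁ is a multiset of classical formulas, there is a PL(∨∨) formula φ such that: (i) Γ₁ ⇒ Λ₁,φ and Γ₂,φ ⇒ Δ₂ are derivable in GT⁻; (ii) for i ∈ {+,−} and j the opposite sign, Pⁱ(φ) ⊆ (Pⁱ(Γ₁) ∪ Pʲ(Λ₁)) ∩ (Pʲ(Γ₂) ∪ Pⁱ(Δ₂)); and moreover, if Δ₂ consists of classical formulas then φ is classical. -/

import Mathlib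

/-! Basic propositional team logic PL(∨∨): syntax, team semantics,
resolutions, and the sequent calculi GT, G3cp, GT'. -/

/-- Valuations over a countably infinite set of propositional variables (ℕ). -/
abbrev Val : Type := ℕ → Bool

/-- A team is a set of valuations. -/
abbrev Team : Type := Set Val

/-- Formulas; PL(∨∨) formulas are the well-formed (`WF`) ones, in which
negation is applied only to classical formulas. `disj` is the split
disjunction ∨ and `idisj` the inquisitive disjunction ∨∨. -/
inductive Form : Type where
  | var : ℕ → Form
  | bot : Form
  | neg : Form → Form
  | conj : Form → Form → Form
  | disj : Form → Form → Form
  | idisj : Form → Form → Form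

namespace Form

/-- Classical (CPL) formulas: no inquisitive disjunction. -/
def IsClassical : Form → Prop
  | var _ => True
  | bot => True
  | neg α => IsClassical α
  | conj α β => IsClassical α ∧ IsClassical β
  | disj α β => IsClassical α ∧ IsClassical β
  | idisj _ _ => False

/-- Well-formed formulas = formulas of PL(∨∨): negation applies only to
classical formulas. -/
def WF : Form → Prop
  | var _ => True
  | bot => True
  | neg α => IsClassical α
  | conj φ ψ => WF φ ∧ WF ψ
  | disj φ ψ => WF φ ∧ WF ψ
  | idisj φ ψ => WF φ ∧ WF ψ

/-- Team satisfaction. -/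
def Sat : Form → Team → Prop
  | var p, t => ∀ v ∈ t, v p = true
  | bot, t => t = ∅
  | neg α, t => ∀ v ∈ t, ¬ Sat α {v}
  | conj φ ψ, t => Sat φ t ∧ Sat ψ t
  | disj φ ψ, t => ∃ s u : Team, t = s ∪ u ∧ Sat φ s ∧ Sat ψ u
  | idisj φ ψ, t => Sat φ t ∨ Sat ψ t

/-- Single-valuation (classical) satisfaction, for classical formulas. -/
def CSat : Form → Val → Prop
  | var p, v => v p = true
  | bot, _ => False
  | neg α, v => ¬ CSat α v
  | conj α β, v => CSat α v ∧ CSat β v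
  | disj α β, v => CSat α v ∨ CSat β v
  | idisj _ _, _ => False

/-- The set of resolutions of a formula. -/
def res : Form → Set Form
  | var p => {var p}
  | bot => {bot}
  | neg α => Form.neg '' res α
  | conj φ ψ => Set.image2 Form.conj (res φ) (res ψ)
  | disj φ ψ => Set.image2 Form.disj (res φ) (res ψ)
  | idisj φ ψ => res φ ∪ res ψ

/-- Propositional variables occurring in a formula. -/
def vars : Form → Set ℕ
  | var p => {p}
  | bot => ∅
  | neg α => vars α
  | conj φ ψ => vars φ ∪ vars ψ
  | disj φ ψ => vars φ ∪ vars ψ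
  | idisj φ ψ => vars φ ∪ vars ψ

/-- Signed occurrences: `svars φ true` = positively occurring variables,
`svars φ false` = negatively occurring variables. -/
def svars : Form → Bool → Set ℕ
  | var p, b => if b then {p} else ∅
  | bot, _ => ∅
  | neg α, b => svars α (!b)
  | conj φ ψ, b => svars φ b ∪ svars ψ b
  | disj φ ψ, b => svars φ b ∪ svars ψ b
  | idisj φ ψ, b => svars φ b ∪ svars ψ b

/-- Positively occurring variables P⁺(φ). -/
def pvars (φ : Form) : Set ℕ := φ.svars true

/-- Negatively occurring variables P⁻(φ). -/
def nvars (φ : Form) : Set ℕ := φ.svars false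

end Form

/-- `t ⊨ Γ`: every formula of the multiset Γ is satisfied by `t`. -/
def SatAll (t : Team) (Γ : Multiset Form) : Prop := ∀ φ ∈ Γ, Form.Sat φ t

/-- Team entailment Γ ⊨ φ. -/
def Entails (Γ : Multiset Form) (φ : Form) : Prop :=
  ∀ t : Team, SatAll t Γ → Form.Sat φ t

/-- Resolutions R(Γ) of a multiset of formulas: images of Γ under resolution
functions. -/
def mres (Γ : Multiset Form) : Set (Multiset Form) :=
  {Ξ | ∃ f : Form → Form, (∀ φ ∈ Γ, f φ ∈ Form.res φ) ∧ Ξ = Γ.map f}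

/-- Variables occurring in a multiset of formulas. -/
def mvars (Γ : Multiset Form) : Set ℕ := {p | ∃ φ ∈ Γ, p ∈ Form.vars φ}

/-- P⁺(Γ). -/
def mpvars (Γ : Multiset Form) : Set ℕ := {p | ∃ φ ∈ Γ, p ∈ Form.pvars φ}

/-- P⁻(Γ). -/
def mnvars (Γ : Multiset Form) : Set ℕ := {p | ∃ φ ∈ Γ, p ∈ Form.nvars φ}

/-- The split disjunction ⋁Δ of a multiset (⊥ for the empty multiset).
(Satisfaction is invariant under the order of the chosen list.) -/
noncomputable def bigVee (Δ : Multiset Form) : Form :=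
  Δ.toList.foldr Form.disj Form.bot

/-- One-hole formula contexts in which the hole does not occur in the scope
of a negation; these represent the subformula occurrences to which the
deep-inference rules may be applied. -/
inductive Ctx : Type where
  | hole : Ctx
  | conjL : Ctx → Form → Ctx
  | conjR : Form → Ctx → Ctx
  | disjL : Ctx → Form → Ctx
  | disjR : Form → Ctx → Ctx
  | idisjL : Ctx → Form → Ctx
  | idisjR : Form → Ctx → Ctx

/-- Plugging a formula into a context: χ{η}. -/
def Ctx.fill : Ctx → Form → Form
  | .hole, η => η
  | .conjL c ψ, η => Form.conj (c.fill η) ψ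
  | .conjR ψ c, η => Form.conj ψ (c.fill η)
  | .disjL c ψ, η => Form.disj (c.fill η) ψ
  | .disjR ψ c, η => Form.disj ψ (c.fill η)
  | .idisjL c ψ, η => Form.idisj (c.fill η) ψ
  | .idisjR ψ c, η => Form.idisj ψ (c.fill η)

/-- The sequent calculus GT. `GT c n Γ Δ` means: the sequent Γ ⇒ Δ has a
derivation of height at most `n`, using Cut only if `c = true`.
So `∃ n, GT true n Γ Δ` is derivability in GT, `∃ n, GT false n Γ Δ` is
derivability in the cut-free fragment GT⁻, and `GT false n Γ Δ` is
`⊢ⁿ Γ ⇒ Δ` (cut-free derivability with height at most n). -/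
inductive GT : Bool → ℕ → Multiset Form → Multiset Form → Prop
  | ax (c : Bool) (n : ℕ) (Γ Δ : Multiset Form) (p : ℕ) :
      GT c (n + 1) (Form.var p ::ₘ Γ) (Form.var p ::ₘ Δ)
  | lbot (c : Bool) (n : ℕ) (Γ Δ : Multiset Form) :
      GT c (n + 1) (Form.bot ::ₘ Γ) Δ
  | lneg (c : Bool) (n : ℕ) (Γ Δ : Multiset Form) (α : Form) :
      Form.IsClassical α → GT c n Γ (α ::ₘ Δ) →
      GT c (n + 1) (Form.neg α ::ₘ Γ) Δ
  | rneg (c : Bool) (n : ℕ) (Γ Δ : Multiset Form) (α : Form) :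
      Form.IsClassical α → GT c n (α ::ₘ Γ) Δ →
      GT c (n + 1) Γ (Form.neg α ::ₘ Δ)
  | lconj (c : Bool) (n : ℕ) (Γ Δ : Multiset Form) (φ ψ : Form) :
      GT c n (φ ::ₘ ψ ::ₘ Γ) Δ →
      GT c (n + 1) (Form.conj φ ψ ::ₘ Γ) Δ
  | rconj (c : Bool) (n : ℕ) (Γ Λ Δ : Multiset Form) (φ ψ : Form) :
      (∀ γ ∈ Λ, Form.IsClassical γ) →
      GT c n Γ (φ ::ₘ Λ) → GT c n Γ (ψ ::ₘ Λ) →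
      GT c (n + 1) Γ (Form.conj φ ψ ::ₘ (Λ + Δ))
  | ldisj (c : Bool) (n : ℕ) (Γ Λ Δ : Multiset Form) (φ ψ : Form) :
      (∀ γ ∈ Λ, Form.IsClassical γ) →
      GT c n (φ ::ₘ Γ) Λ → GT c n (ψ ::ₘ Γ) Λ →
      GT c (n + 1) (Form.disj φ ψ ::ₘ Γ) (Λ + Δ)
  | rdisj (c : Bool) (n : ℕ) (Γ Δ : Multiset Form) (φ ψ : Form) :
      GT c n Γ (φ ::ₘ ψ ::ₘ Δ) →
      GT c (n + 1) Γ (Form.disj φ ψ ::ₘ Δ)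
  | lidisj (c : Bool) (n : ℕ) (Γ Δ : Multiset Form) (χ : Ctx) (φL φR : Form) :
      GT c n (χ.fill φL ::ₘ Γ) Δ → GT c n (χ.fill φR ::ₘ Γ) Δ →
      GT c (n + 1) (χ.fill (Form.idisj φL φR) ::ₘ Γ) Δ
  | ridisjL (c : Bool) (n : ℕ) (Γ Δ : Multiset Form) (χ : Ctx) (φL φR : Form) :
      GT c n Γ (χ.fill φL ::ₘ Δ) →
      GT c (n + 1) Γ (χ.fill (Form.idisj φL φR) ::ₘ Δ)
  | ridisjR (c : Bool) (n : ℕ) (Γ Δ : Multiset Form) (χ : Ctx) (φL φR : Form) :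
      GT c n Γ (χ.fill φR ::ₘ Δ) →
      GT c (n + 1) Γ (χ.fill (Form.idisj φL φR) ::ₘ Δ)
  | cut (n : ℕ) (Γ Δ Θ S : Multiset Form) (φ : Form) :
      GT true n Γ (φ ::ₘ Δ) → GT true n (φ ::ₘ Θ) S →
      GT true (n + 1) (Γ + Θ) (Δ + S)

/-- The classical sequent calculus G3cp (on classical formulas).
`G3 false` is its cut-free fragment G3cp⁻. -/
inductive G3 : Bool → Multiset Form → Multiset Form → Prop
  | ax (c : Bool) (Γ Δ : Multiset Form) (p : ℕ) :
      (∀ α ∈ Γ, Form.IsClassical α) → (∀ α ∈ Δ, Form.IsClassical α) →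
      G3 c (Form.var p ::ₘ Γ) (Form.var p ::ₘ Δ)
  | lbot (c : Bool) (Γ Δ : Multiset Form) :
      (∀ α ∈ Γ, Form.IsClassical α) → (∀ α ∈ Δ, Form.IsClassical α) →
      G3 c (Form.bot ::ₘ Γ) Δ
  | lneg (c : Bool) (Γ Δ : Multiset Form) (α : Form) :
      Form.IsClassical α → G3 c Γ (α ::ₘ Δ) → G3 c (Form.neg α ::ₘ Γ) Δ
  | rneg (c : Bool) (Γ Δ : Multiset Form) (α : Form) :
      Form.IsClassical α → G3 c (α ::ₘ Γ) Δ → G3 c Γ (Form.neg α ::ₘ Δ)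
  | lconj (c : Bool) (Γ Δ : Multiset Form) (α β : Form) :
      G3 c (α ::ₘ β ::ₘ Γ) Δ → G3 c (Form.conj α β ::ₘ Γ) Δ
  | rconj (c : Bool) (Γ Λ Δ : Multiset Form) (α β : Form) :
      (∀ γ ∈ Λ, Form.IsClassical γ) → (∀ γ ∈ Δ, Form.IsClassical γ) →
      G3 c Γ (α ::ₘ Λ) → G3 c Γ (β ::ₘ Λ) →
      G3 c Γ (Form.conj α β ::ₘ (Λ + Δ))
  | ldisj (c : Bool) (Γ Λ Δ : Multiset Form) (α β : Form) :
      (∀ γ ∈ Λ, Form.IsClassical γ) → (∀ γ ∈ Δ, Form.IsClassical γ) →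
      G3 c (α ::ₘ Γ) Λ → G3 c (β ::ₘ Γ) Λ →
      G3 c (Form.disj α β ::ₘ Γ) (Λ + Δ)
  | rdisj (c : Bool) (Γ Δ : Multiset Form) (α β : Form) :
      G3 c Γ (α ::ₘ β ::ₘ Δ) → G3 c Γ (Form.disj α β ::ₘ Δ)
  | cut (Γ Δ Θ S : Multiset Form) (α : Form) :
      Form.IsClassical α →
      G3 true Γ (α ::ₘ Δ) → G3 true (α ::ₘ Θ) S →
      G3 true (Γ + Θ) (Δ + S)

/-- The cut-free variant calculus GT'⁻: GT⁻ with independent-context rules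
R∧', L∨' in place of R∧, L∨, plus explicit contraction rules LC and RC
(RC restricted to classical formulas). -/
inductive GTp : Multiset Form → Multiset Form → Prop
  | ax (Γ Δ : Multiset Form) (p : ℕ) :
      GTp (Form.var p ::ₘ Γ) (Form.var p ::ₘ Δ)
  | lbot (Γ Δ : Multiset Form) : GTp (Form.bot ::ₘ Γ) Δ
  | lneg (Γ Δ : Multiset Form) (α : Form) :
      Form.IsClassical α → GTp Γ (α ::ₘ Δ) → GTp (Form.neg α ::ₘ Γ) Δ
  | rneg (Γ Δ : Multiset Form) (α : Form) :
      Form.IsClassical α → GTp (α ::ₘ Γ) Δ → GTp Γ (Form.neg α ::ₘ Δ)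
  | lconj (Γ Δ : Multiset Form) (φ ψ : Form) :
      GTp (φ ::ₘ ψ ::ₘ Γ) Δ → GTp (Form.conj φ ψ ::ₘ Γ) Δ
  | rconj (Γ₁ Γ₂ Δ₁ Δ₂ : Multiset Form) (φ ψ : Form) :
      GTp Γ₁ (φ ::ₘ Δ₁) → GTp Γ₂ (ψ ::ₘ Δ₂) →
      GTp (Γ₁ + Γ₂) (Form.conj φ ψ ::ₘ (Δ₁ + Δ₂))
  | ldisj (Γ₁ Γ₂ Δ₁ Δ₂ : Multiset Form) (φ ψ : Form) :
      GTp (φ ::ₘ Γ₁) Δ₁ → GTp (ψ ::ₘ Γ₂) Δ₂ →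
      GTp (Form.disj φ ψ ::ₘ (Γ₁ + Γ₂)) (Δ₁ + Δ₂)
  | rdisj (Γ Δ : Multiset Form) (φ ψ : Form) :
      GTp Γ (φ ::ₘ ψ ::ₘ Δ) → GTp Γ (Form.disj φ ψ ::ₘ Δ)
  | lidisj (Γ Δ : Multiset Form) (χ : Ctx) (φL φR : Form) :
      GTp (χ.fill φL ::ₘ Γ) Δ → GTp (χ.fill φR ::ₘ Γ) Δ →
      GTp (χ.fill (Form.idisj φL φR) ::ₘ Γ) Δ
  | ridisjL (Γ Δ : Multiset Form) (χ : Ctx) (φL φR : Form) :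
      GTp Γ (χ.fill φL ::ₘ Δ) → GTp Γ (χ.fill (Form.idisj φL φR) ::ₘ Δ)
  | ridisjR (Γ Δ : Multiset Form) (χ : Ctx) (φL φR : Form) :
      GTp Γ (χ.fill φR ::ₘ Δ) → GTp Γ (χ.fill (Form.idisj φL φR) ::ₘ Δ)
  | lc (Γ Δ : Multiset Form) (φ : Form) :
      GTp (φ ::ₘ φ ::ₘ Γ) Δ → GTp (φ ::ₘ Γ) Δ
  | rc (Γ Δ : Multiset Form) (α : Form) :
      Form.IsClassical α → GTp Γ (α ::ₘ α ::ₘ Δ) → GTp Γ (α ::ₘ Δ)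

/-! ### Deep contexts and inquisitive disjunctions -/

namespace Form

theorem IsClassical.wf : ∀ {φ : Form}, φ.IsClassical → φ.WF
  | var _, _ => trivial
  | bot, _ => trivial
  | neg _, h => h
  | conj _ _, h => ⟨h.1.wf, h.2.wf⟩
  | disj _ _, h => ⟨h.1.wf, h.2.wf⟩

/-- Number of inquisitive disjunctions in a formula. -/
def idisjCount : Form → ℕ
  | var _ => 0
  | bot => 0
  | neg α => idisjCount α
  | conj φ ψ => idisjCount φ + idisjCount ψ
  | disj φ ψ => idisjCount φ + idisjCount ψ
  | idisj φ ψ => idisjCount φ + idisjCount ψ + 1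

/-- Number of connectives and atoms in a formula. -/
def size : Form → ℕ
  | var _ => 1
  | bot => 1
  | neg α => size α + 1
  | conj φ ψ => size φ + size ψ + 1
  | disj φ ψ => size φ + size ψ + 1
  | idisj φ ψ => size φ + size ψ + 1

theorem finite_svars (φ : Form) (b : Bool) : (φ.svars b).Finite := by
  induction φ generalizing b with
  | var p => cases b <;> simp [svars]
  | bot => simp [svars]
  | neg α ih => exact ih _
  | conj φ ψ ih₁ ih₂ => exact (ih₁ b).union (ih₂ b)
  | disj φ ψ ih₁ ih₂ => exact (ih₁ b).union (ih₂ b)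
  | idisj φ ψ ih₁ ih₂ => exact (ih₁ b).union (ih₂ b)

theorem WF.exists_fill_idisj {φ : Form} (h : φ.WF) (hc : ¬ φ.IsClassical) :
    ∃ (χ : Ctx) (a b : Form), φ = χ.fill (idisj a b) := by
  induction φ with
  | var p => exact absurd trivial hc
  | bot => exact absurd trivial hc
  | neg α _ => exact absurd h hc
  | conj φ ψ ih₁ ih₂ =>
    by_cases h₁ : φ.IsClassical
    · obtain ⟨χ, a, b, e⟩ := ih₂ h.2 fun h₂ => hc ⟨h₁, h₂⟩
      exact ⟨.conjR φ χ, a, b, by rw [e]; rfl⟩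
    · obtain ⟨χ, a, b, e⟩ := ih₁ h.1 h₁
      exact ⟨.conjL χ ψ, a, b, by rw [e]; rfl⟩
  | disj φ ψ ih₁ ih₂ =>
    by_cases h₁ : φ.IsClassical
    · obtain ⟨χ, a, b, e⟩ := ih₂ h.2 fun h₂ => hc ⟨h₁, h₂⟩
      exact ⟨.disjR φ χ, a, b, by rw [e]; rfl⟩
    · obtain ⟨χ, a, b, e⟩ := ih₁ h.1 h₁
      exact ⟨.disjL χ ψ, a, b, by rw [e]; rfl⟩
  | idisj φ ψ _ _ => exact ⟨.hole, φ, ψ, rfl⟩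

end Form

namespace Ctx

theorem wf_fill (χ : Ctx) {a b : Form} (h : (χ.fill a).WF) (hab : a.WF → b.WF) :
    (χ.fill b).WF := by
  induction χ with
  | hole => exact hab h
  | conjL c ψ ih => exact ⟨ih h.1, h.2⟩
  | conjR ψ c ih => exact ⟨h.1, ih h.2⟩
  | disjL c ψ ih => exact ⟨ih h.1, h.2⟩
  | disjR ψ c ih => exact ⟨h.1, ih h.2⟩
  | idisjL c ψ ih => exact ⟨ih h.1, h.2⟩
  | idisjR ψ c ih => exact ⟨h.1, ih h.2⟩

theorem idisjCount_fill_lt (χ : Ctx) {a b : Form} (h : a.idisjCount < b.idisjCount) :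
    (χ.fill a).idisjCount < (χ.fill b).idisjCount := by
  induction χ <;> simp only [fill, Form.idisjCount] <;> omega

theorem svars_fill_subset (χ : Ctx) {a b : Form} {i : Bool} (h : a.svars i ⊆ b.svars i) :
    (χ.fill a).svars i ⊆ (χ.fill b).svars i := by
  induction χ with
  | hole => exact h
  | conjL c ψ ih => exact Set.union_subset_union_left _ ih
  | conjR ψ c ih => exact Set.union_subset_union_right _ ih
  | disjL c ψ ih => exact Set.union_subset_union_left _ ih
  | disjR ψ c ih => exact Set.union_subset_union_right _ ih
  | idisjL c ψ ih => exact Set.union_subset_union_left _ ih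
  | idisjR ψ c ih => exact Set.union_subset_union_right _ ih

theorem not_isClassical_fill_idisj (χ : Ctx) {a b : Form} :
    ¬ (χ.fill (.idisj a b)).IsClassical := by
  induction χ <;> simp_all [fill, Form.IsClassical]

theorem sat_fill_mono (χ : Ctx) {a b : Form} (h : ∀ t, a.Sat t → b.Sat t) {t : Team}
    (ht : (χ.fill a).Sat t) : (χ.fill b).Sat t := by
  induction χ generalizing t with
  | hole => exact h t ht
  | conjL c ψ ih => exact ⟨ih ht.1, ht.2⟩
  | conjR ψ c ih => exact ⟨ht.1, ih ht.2⟩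
  | disjL c ψ ih =>
    obtain ⟨s, u, e, hs, hu⟩ := ht
    exact ⟨s, u, e, ih hs, hu⟩
  | disjR ψ c ih =>
    obtain ⟨s, u, e, hs, hu⟩ := ht
    exact ⟨s, u, e, hs, ih hu⟩
  | idisjL c ψ ih => exact ht.imp_left ih
  | idisjR ψ c ih => exact ht.imp_right ih

theorem sat_fill_idisj (χ : Ctx) {a b : Form} {t : Team} :
    (χ.fill (.idisj a b)).Sat t ↔ (χ.fill a).Sat t ∨ (χ.fill b).Sat t := by
  refine ⟨fun h => ?_, fun h => h.elim (χ.sat_fill_mono fun _ => Or.inl)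
    (χ.sat_fill_mono fun _ => Or.inr)⟩
  induction χ generalizing t with
  | hole => exact h
  | conjL c ψ ih => exact (ih h.1).imp (⟨·, h.2⟩) (⟨·, h.2⟩)
  | conjR ψ c ih => exact (ih h.2).imp (⟨h.1, ·⟩) (⟨h.1, ·⟩)
  | disjL c ψ ih =>
    obtain ⟨s, u, e, hs, hu⟩ := h
    exact (ih hs).imp (⟨s, u, e, ·, hu⟩) (⟨s, u, e, ·, hu⟩)
  | disjR ψ c ih =>
    obtain ⟨s, u, e, hs, hu⟩ := h
    exact (ih hu).imp (⟨s, u, e, hs, ·⟩) (⟨s, u, e, hs, ·⟩)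
  | idisjL c ψ ih =>
    exact h.elim (fun h => (ih h).imp Or.inl Or.inl) fun h => Or.inl (Or.inr h)
  | idisjR ψ c ih =>
    exact h.elim (fun h => Or.inl (Or.inl h)) fun h => (ih h).imp Or.inr Or.inr

end Ctx

/-- To prove a property of all multisets of well-formed formulas, prove it for the classical ones
and show that it passes from both instances of an inquisitive disjunction to the disjunction. -/
theorem wf_multiset_induction {P : Multiset Form → Prop}
    (classical : ∀ Γ : Multiset Form, (∀ φ ∈ Γ, φ.IsClassical) → P Γ)
    (idisj : ∀ (Γ : Multiset Form) (χ : Ctx) (a b : Form),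
      P (χ.fill a ::ₘ Γ) → P (χ.fill b ::ₘ Γ) → P (χ.fill (.idisj a b) ::ₘ Γ))
    (Γ : Multiset Form) (hΓ : ∀ φ ∈ Γ, φ.WF) : P Γ := by
  induction hn : (Γ.map Form.idisjCount).sum using Nat.strong_induction_on generalizing Γ with
  | _ n ih =>
    by_cases hc : ∀ φ ∈ Γ, φ.IsClassical
    · exact classical Γ hc
    push Not at hc
    obtain ⟨φ, hφ, hcφ⟩ := hc
    obtain ⟨χ, a, b, rfl⟩ := (hΓ φ hφ).exists_fill_idisj hcφ
    obtain ⟨Γ', rfl⟩ := Multiset.exists_cons_of_mem hφ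
    rw [Multiset.forall_mem_cons] at hΓ
    have ha := χ.idisjCount_fill_lt (a := a) (b := .idisj a b)
      (by simp only [Form.idisjCount]; omega)
    have hb := χ.idisjCount_fill_lt (a := b) (b := .idisj a b)
      (by simp only [Form.idisjCount]; omega)
    simp only [Multiset.map_cons, Multiset.sum_cons] at hn
    refine idisj Γ' χ a b (ih _ ?_ _ ?_ rfl) (ih _ ?_ _ ?_ rfl)
    · simp only [Multiset.map_cons, Multiset.sum_cons]; omega
    · exact Multiset.forall_mem_cons.2 ⟨χ.wf_fill hΓ.1 And.left, hΓ.2⟩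
    · simp only [Multiset.map_cons, Multiset.sum_cons]; omega
    · exact Multiset.forall_mem_cons.2 ⟨χ.wf_fill hΓ.1 And.right, hΓ.2⟩

/-! ### Team semantics of sequents -/

namespace Form

theorem sat_empty (φ : Form) : φ.Sat ∅ := by
  induction φ with
  | var p => simp [Sat]
  | bot => rfl
  | neg α _ => simp [Sat]
  | conj φ ψ ih₁ ih₂ => exact ⟨ih₁, ih₂⟩
  | disj φ ψ ih₁ ih₂ => exact ⟨∅, ∅, by simp, ih₁, ih₂⟩
  | idisj φ ψ ih₁ _ => exact Or.inl ih₁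

theorem Sat.mono {φ : Form} {t s : Team} (h : φ.Sat t) (hst : s ⊆ t) : φ.Sat s := by
  induction φ generalizing t s with
  | var p => exact fun v hv => h v (hst hv)
  | bot => exact Set.subset_empty_iff.1 (hst.trans_eq h)
  | neg α _ => exact fun v hv => h v (hst hv)
  | conj φ ψ ih₁ ih₂ => exact ⟨ih₁ h.1 hst, ih₂ h.2 hst⟩
  | disj φ ψ ih₁ ih₂ =>
    obtain ⟨t₁, t₂, rfl, h₁, h₂⟩ := h
    refine ⟨s ∩ t₁, s ∩ t₂, ?_, ih₁ h₁ Set.inter_subset_right, ih₂ h₂ Set.inter_subset_right⟩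
    rw [← Set.inter_union_distrib_left, Set.inter_eq_left.2 hst]
  | idisj φ ψ ih₁ ih₂ => exact h.imp (ih₁ · hst) (ih₂ · hst)

theorem IsClassical.sat_iff {α : Form} (hα : α.IsClassical) {t : Team} :
    α.Sat t ↔ ∀ v ∈ t, α.CSat v := by
  induction α generalizing t with
  | var p => rfl
  | bot => simp [Sat, CSat, Set.eq_empty_iff_forall_notMem]
  | neg α ih => simp [Sat, CSat, ih hα]
  | conj α β ih₁ ih₂ =>
    simp only [Sat, CSat, ih₁ hα.1, ih₂ hα.2]
    grind
  | disj α β ih₁ ih₂ =>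
    simp only [Sat, CSat, ih₁ hα.1, ih₂ hα.2]
    constructor
    · rintro ⟨s, u, rfl, hs, hu⟩ v (hv | hv)
      exacts [Or.inl (hs v hv), Or.inr (hu v hv)]
    · intro h
      refine ⟨{v ∈ t | α.CSat v}, {v ∈ t | β.CSat v}, ?_, fun v hv => hv.2, fun v hv => hv.2⟩
      ext v
      have := h v
      simp only [Set.mem_union, Set.mem_ofPred_eq]
      tauto
  | idisj α β _ _ => exact hα.elim

end Form

theorem satAll_cons {t : Team} {φ : Form} {Γ : Multiset Form} :
    SatAll t (φ ::ₘ Γ) ↔ φ.Sat t ∧ SatAll t Γ :=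
  Multiset.forall_mem_cons

theorem satAll_add {t : Team} {Γ Θ : Multiset Form} :
    SatAll t (Γ + Θ) ↔ SatAll t Γ ∧ SatAll t Θ := by
  simp only [SatAll, Multiset.mem_add, or_imp, forall_and]

theorem SatAll.mono {t s : Team} {Γ : Multiset Form} (h : SatAll t Γ) (hst : s ⊆ t) :
    SatAll s Γ :=
  fun φ hφ => (h φ hφ).mono hst

/-- The team property expressed by `φ ∨ ψ` when `P` is the property expressed by `ψ`. -/
def splitStep (φ : Form) (P : Team → Prop) (t : Team) : Prop :=
  ∃ s u : Team, t = s ∪ u ∧ φ.Sat s ∧ P u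

instance : LeftCommutative splitStep where
  left_comm φ ψ P := by
    ext t
    constructor
    · rintro ⟨s, _, rfl, hs, u, w, rfl, hu, hw⟩
      exact ⟨u, s ∪ w, Set.union_left_comm s u w, hu, s, w, rfl, hs, hw⟩
    · rintro ⟨s, _, rfl, hs, u, w, rfl, hu, hw⟩
      exact ⟨u, s ∪ w, Set.union_left_comm s u w, hu, s, w, rfl, hs, hw⟩

/-- `SatSome t Δ`: the team `t` satisfies the split disjunction of `Δ`. -/
def SatSome (t : Team) (Δ : Multiset Form) : Prop :=
  Δ.foldr splitStep (fun u => u = ∅) t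

theorem satSome_cons {t : Team} {φ : Form} {Δ : Multiset Form} :
    SatSome t (φ ::ₘ Δ) ↔ ∃ s u : Team, t = s ∪ u ∧ φ.Sat s ∧ SatSome u Δ := by
  rw [SatSome, Multiset.foldr_cons]
  rfl

theorem satSome_zero {t : Team} : SatSome t 0 ↔ t = ∅ := by
  rw [SatSome, Multiset.foldr_zero]

theorem satSome_empty (Δ : Multiset Form) : SatSome ∅ Δ := by
  induction Δ using Multiset.induction with
  | empty => exact satSome_zero.2 rfl
  | cons φ Δ ih => exact satSome_cons.2 ⟨∅, ∅, by simp, φ.sat_empty, ih⟩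

theorem SatSome.mono {t s : Team} {Δ : Multiset Form} (h : SatSome t Δ) (hst : s ⊆ t) :
    SatSome s Δ := by
  induction Δ using Multiset.induction generalizing t s with
  | empty =>
    rw [satSome_zero] at *
    exact Set.subset_empty_iff.1 (hst.trans_eq h)
  | cons φ Δ ih =>
    obtain ⟨t₁, t₂, rfl, h₁, h₂⟩ := satSome_cons.1 h
    refine satSome_cons.2 ⟨s ∩ t₁, s ∩ t₂, ?_, h₁.mono Set.inter_subset_right,
      ih h₂ Set.inter_subset_right⟩
    rw [← Set.inter_union_distrib_left, Set.inter_eq_left.2 hst]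

theorem satSome_add {t : Team} {Δ S : Multiset Form} :
    SatSome t (Δ + S) ↔ ∃ s u : Team, t = s ∪ u ∧ SatSome s Δ ∧ SatSome u S := by
  induction Δ using Multiset.induction generalizing t with
  | empty => simp [satSome_zero]
  | cons φ Δ ih =>
    simp only [Multiset.cons_add, satSome_cons, ih]
    constructor
    · rintro ⟨s, _, rfl, hs, u, w, rfl, hu, hw⟩
      exact ⟨s ∪ u, w, (Set.union_assoc s u w).symm, ⟨s, u, rfl, hs, hu⟩, hw⟩
    · rintro ⟨_, w, rfl, ⟨s, u, rfl, hs, hu⟩, hw⟩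
      exact ⟨s, u ∪ w, Set.union_assoc s u w, hs, u, w, rfl, hu, hw⟩

theorem satSome_iff_of_classical {Λ : Multiset Form} (hΛ : ∀ α ∈ Λ, α.IsClassical) {t : Team} :
    SatSome t Λ ↔ ∀ v ∈ t, ∃ α ∈ Λ, α.CSat v := by
  induction Λ using Multiset.induction generalizing t with
  | empty => simp [satSome_zero, Set.eq_empty_iff_forall_notMem]
  | cons α Λ ih =>
    rw [Multiset.forall_mem_cons] at hΛ
    simp only [satSome_cons, hΛ.1.sat_iff, ih hΛ.2, Multiset.mem_cons, exists_eq_or_imp]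
    constructor
    · rintro ⟨s, u, rfl, hs, hu⟩ v (hv | hv)
      exacts [Or.inl (hs v hv), Or.inr (hu v hv)]
    · intro h
      refine ⟨{v ∈ t | α.CSat v}, {v ∈ t | ∃ β ∈ Λ, β.CSat v}, ?_, fun v hv => hv.2,
        fun v hv => hv.2⟩
      ext v
      have := h v
      simp only [Set.mem_union, Set.mem_ofPred_eq]
      tauto

theorem satAll_iff_of_classical {Γ : Multiset Form} (hΓ : ∀ α ∈ Γ, α.IsClassical) {t : Team} :
    SatAll t Γ ↔ ∀ v ∈ t, ∀ α ∈ Γ, α.CSat v :=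
  ⟨fun h v hv α hα => (hΓ α hα).sat_iff.1 (h α hα) v hv,
    fun h α hα => (hΓ α hα).sat_iff.2 fun v hv => h v hv α hα⟩

theorem satSome_union_of_classical {Λ : Multiset Form} (hΛ : ∀ α ∈ Λ, α.IsClassical)
    {s u : Team} (hs : SatSome s Λ) (hu : SatSome u Λ) : SatSome (s ∪ u) Λ := by
  rw [satSome_iff_of_classical hΛ] at *
  rintro v (hv | hv)
  exacts [hs v hv, hu v hv]

/-- Validity of a sequent. -/
def Valid (Γ Δ : Multiset Form) : Prop :=
  ∀ t : Team, SatAll t Γ → SatSome t Δ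

theorem valid_iff_of_classical {Γ Δ : Multiset Form} (hΓ : ∀ α ∈ Γ, α.IsClassical)
    (hΔ : ∀ α ∈ Δ, α.IsClassical) :
    Valid Γ Δ ↔ ∀ v, (∀ α ∈ Γ, α.CSat v) → ∃ α ∈ Δ, α.CSat v := by
  simp only [Valid, satAll_iff_of_classical hΓ, satSome_iff_of_classical hΔ]
  exact ⟨fun h v hv => h {v} (by simpa using hv) v rfl, fun h t ht v hv => h v (ht v hv)⟩

namespace Valid

variable {Γ Δ Θ S Λ : Multiset Form} {φ ψ α : Form}

theorem lneg (h : Valid Γ (α ::ₘ Δ)) (hα : α.IsClassical) : Valid (.neg α ::ₘ Γ) Δ := by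
  intro t ht
  obtain ⟨ht₁, ht₂⟩ := satAll_cons.1 ht
  obtain ⟨s, u, rfl, hs, hu⟩ := satSome_cons.1 (h t ht₂)
  rw [Form.IsClassical.sat_iff (α := .neg α) hα] at ht₁
  rw [hα.sat_iff] at hs
  refine hu.mono (Set.union_subset (fun v hv => ?_) subset_rfl)
  exact (ht₁ v (Or.inl hv) (hs v hv)).elim

theorem rneg (h : Valid (α ::ₘ Γ) Δ) (hα : α.IsClassical) : Valid Γ (.neg α ::ₘ Δ) := by
  intro t ht
  refine satSome_cons.2 ⟨{v ∈ t | ¬ α.CSat v}, {v ∈ t | α.CSat v}, ?_, ?_, h _ ?_⟩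
  · ext v
    simp only [Set.mem_union, Set.mem_ofPred_eq]
    tauto
  · exact (Form.IsClassical.sat_iff (α := .neg α) hα).2 fun v hv => hv.2
  · exact satAll_cons.2 ⟨hα.sat_iff.2 fun v hv => hv.2, ht.mono fun v hv => hv.1⟩

theorem weaken_right (h : Valid Γ Δ) : Valid Γ (Δ + S) :=
  fun t ht => satSome_add.2 ⟨t, ∅, by simp, h t ht, satSome_empty S⟩

theorem rconj (hΛ : ∀ γ ∈ Λ, γ.IsClassical) (h₁ : Valid Γ (φ ::ₘ Λ)) (h₂ : Valid Γ (ψ ::ₘ Λ)) :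
    Valid Γ (.conj φ ψ ::ₘ Λ) := by
  intro t ht
  obtain ⟨s₁, u₁, e₁, hs₁, hu₁⟩ := satSome_cons.1 (h₁ t ht)
  obtain ⟨s₂, u₂, e₂, hs₂, hu₂⟩ := satSome_cons.1 (h₂ t ht)
  refine satSome_cons.2 ⟨s₁ ∩ s₂, u₁ ∪ u₂, ?_, ⟨hs₁.mono Set.inter_subset_left,
    hs₂.mono Set.inter_subset_right⟩, satSome_union_of_classical hΛ hu₁ hu₂⟩
  ext v
  have h₁ := congrArg (v ∈ ·) e₁
  have h₂ := congrArg (v ∈ ·) e₂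
  simp only [Set.mem_union, Set.mem_inter_iff, eq_iff_iff] at *
  tauto

theorem ldisj (hΛ : ∀ γ ∈ Λ, γ.IsClassical) (h₁ : Valid (φ ::ₘ Γ) Λ) (h₂ : Valid (ψ ::ₘ Γ) Λ) :
    Valid (.disj φ ψ ::ₘ Γ) Λ := by
  intro t ht
  obtain ⟨⟨s, u, rfl, hs, hu⟩, ht⟩ := satAll_cons.1 ht
  exact satSome_union_of_classical hΛ
    (h₁ s (satAll_cons.2 ⟨hs, ht.mono Set.subset_union_left⟩))
    (h₂ u (satAll_cons.2 ⟨hu, ht.mono Set.subset_union_right⟩))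

theorem rdisj (h : Valid Γ (φ ::ₘ ψ ::ₘ Δ)) : Valid Γ (.disj φ ψ ::ₘ Δ) := by
  intro t ht
  obtain ⟨s, u, rfl, hs, hu⟩ := satSome_cons.1 (h t ht)
  obtain ⟨u, w, rfl, hu, hw⟩ := satSome_cons.1 hu
  exact satSome_cons.2 ⟨s ∪ u, w, (Set.union_assoc s u w).symm, ⟨s, u, rfl, hs, hu⟩, hw⟩

theorem head_left (h : Valid (φ ::ₘ Γ) Δ) (hφ : ∀ t, ψ.Sat t → φ.Sat t) : Valid (ψ ::ₘ Γ) Δ :=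
  fun t ht => h t (satAll_cons.2 ((satAll_cons.1 ht).imp_left (hφ t)))

theorem head_right (h : Valid Γ (φ ::ₘ Δ)) (hφ : ∀ t, φ.Sat t → ψ.Sat t) :
    Valid Γ (ψ ::ₘ Δ) := by
  intro t ht
  obtain ⟨s, u, e, hs, hu⟩ := satSome_cons.1 (h t ht)
  exact satSome_cons.2 ⟨s, u, e, hφ s hs, hu⟩

theorem lidisj_iff {χ : Ctx} {a b : Form} :
    Valid (χ.fill (.idisj a b) ::ₘ Γ) Δ ↔
      Valid (χ.fill a ::ₘ Γ) Δ ∧ Valid (χ.fill b ::ₘ Γ) Δ := by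
  simp only [Valid, satAll_cons, χ.sat_fill_idisj, or_and_right, or_imp, forall_and]

theorem ridisj_iff (hΓ : ∀ γ ∈ Γ, γ.IsClassical) {χ : Ctx} {a b : Form} :
    Valid Γ (χ.fill (.idisj a b) ::ₘ Δ) ↔
      Valid Γ (χ.fill a ::ₘ Δ) ∨ Valid Γ (χ.fill b ::ₘ Δ) := by
  refine ⟨fun h => ?_, ?_⟩
  · have hΓ' := @satAll_iff_of_classical Γ hΓ
    obtain ⟨s, u, e, hs, hu⟩ := satSome_cons.1
      (h {v | ∀ α ∈ Γ, α.CSat v} (hΓ'.2 fun v hv => hv))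
    refine (χ.sat_fill_idisj.1 hs).imp (fun hs t ht => ?_) (fun hs t ht => ?_) <;>
    exact (satSome_cons.2 ⟨s, u, e, hs, hu⟩).mono (hΓ'.1 ht)
  · rintro (h | h)
    · exact h.head_right fun t ht => χ.sat_fill_idisj.2 (Or.inl ht)
    · exact h.head_right fun t ht => χ.sat_fill_idisj.2 (Or.inr ht)

theorem cut (h₁ : Valid Γ (φ ::ₘ Δ)) (h₂ : Valid (φ ::ₘ Θ) S) : Valid (Γ + Θ) (Δ + S) := by
  intro t ht
  obtain ⟨htΓ, htΘ⟩ := satAll_add.1 ht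
  obtain ⟨s, u, rfl, hs, hu⟩ := satSome_cons.1 (h₁ t htΓ)
  exact satSome_add.2 ⟨u, s, Set.union_comm s u, hu,
    h₂ s (satAll_cons.2 ⟨hs, htΘ.mono Set.subset_union_left⟩)⟩

end Valid

theorem GT.sound {c : Bool} {n : ℕ} {Γ Δ : Multiset Form} (h : GT c n Γ Δ) : Valid Γ Δ := by
  induction h with
  | ax c n Γ Δ p =>
    intro t ht
    exact satSome_cons.2 ⟨t, ∅, by simp, (satAll_cons.1 ht).1, satSome_empty Δ⟩
  | lbot c n Γ Δ =>
    intro t ht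
    have ht : t = ∅ := (satAll_cons.1 ht).1
    exact ht ▸ satSome_empty Δ
  | lneg c n Γ Δ α hα _ ih => exact ih.lneg hα
  | rneg c n Γ Δ α hα _ ih => exact ih.rneg hα
  | lconj c n Γ Δ φ ψ _ ih =>
    intro t ht
    obtain ⟨⟨h₁, h₂⟩, ht⟩ := satAll_cons.1 ht
    exact ih t (satAll_cons.2 ⟨h₁, satAll_cons.2 ⟨h₂, ht⟩⟩)
  | rconj c n Γ Λ Δ φ ψ hΛ _ _ ih₁ ih₂ =>
    rw [← Multiset.cons_add]
    exact (Valid.rconj hΛ ih₁ ih₂).weaken_right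
  | ldisj c n Γ Λ Δ φ ψ hΛ _ _ ih₁ ih₂ => exact (Valid.ldisj hΛ ih₁ ih₂).weaken_right
  | rdisj c n Γ Δ φ ψ _ ih => exact ih.rdisj
  | lidisj c n Γ Δ χ a b _ _ ih₁ ih₂ => exact Valid.lidisj_iff.2 ⟨ih₁, ih₂⟩
  | ridisjL c n Γ Δ χ a b _ ih =>
    exact ih.head_right fun t ht => χ.sat_fill_idisj.2 (Or.inl ht)
  | ridisjR c n Γ Δ χ a b _ ih =>
    exact ih.head_right fun t ht => χ.sat_fill_idisj.2 (Or.inr ht)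
  | cut n Γ Δ Θ S φ _ _ ih₁ ih₂ => exact ih₁.cut ih₂

/-! ### Cut-free completeness -/

theorem GT.mono {c : Bool} {n m : ℕ} {Γ Δ : Multiset Form} (h : GT c n Γ Δ) (hnm : n ≤ m) :
    GT c m Γ Δ := by
  induction h generalizing m <;> obtain ⟨m, rfl⟩ := Nat.exists_eq_add_of_le' hnm <;>
    simp only [← Nat.add_assoc] at *
  case ax => exact .ax ..
  case lbot => exact .lbot ..
  case lneg hα _ ih => exact .lneg _ _ _ _ _ hα (ih (by omega))
  case rneg hα _ ih => exact .rneg _ _ _ _ _ hα (ih (by omega))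
  case lconj ih => exact .lconj _ _ _ _ _ _ (ih (by omega))
  case rconj hΛ _ _ ih₁ ih₂ => exact .rconj _ _ _ _ _ _ _ hΛ (ih₁ (by omega)) (ih₂ (by omega))
  case ldisj hΛ _ _ ih₁ ih₂ => exact .ldisj _ _ _ _ _ _ _ hΛ (ih₁ (by omega)) (ih₂ (by omega))
  case rdisj ih => exact .rdisj _ _ _ _ _ _ (ih (by omega))
  case lidisj ih₁ ih₂ => exact .lidisj _ _ _ _ _ _ _ (ih₁ (by omega)) (ih₂ (by omega))
  case ridisjL ih => exact .ridisjL _ _ _ _ _ _ _ (ih (by omega))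
  case ridisjR ih => exact .ridisjR _ _ _ _ _ _ _ (ih (by omega))
  case cut ih₁ ih₂ => exact .cut _ _ _ _ _ _ (ih₁ (by omega)) (ih₂ (by omega))

theorem GT.exists_common_height {c : Bool} {Γ Δ Θ S : Multiset Form}
    (h₁ : ∃ n, GT c n Γ Δ) (h₂ : ∃ n, GT c n Θ S) : ∃ n, GT c n Γ Δ ∧ GT c n Θ S := by
  obtain ⟨n, h₁⟩ := h₁
  obtain ⟨m, h₂⟩ := h₂
  exact ⟨max n m, h₁.mono (le_max_left n m), h₂.mono (le_max_right n m)⟩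

theorem Form.IsClassical.cases {α : Form} (h : α.IsClassical) :
    (∃ p, α = .var p) ∨ α = .bot ∨ (∃ β, α = .neg β) ∨ (∃ β γ, α = .conj β γ) ∨
      ∃ β γ, α = .disj β γ := by
  cases α <;> simp_all [Form.IsClassical]

theorem GT.complete_of_classical (Γ Δ : Multiset Form) (hΓ : ∀ α ∈ Γ, α.IsClassical)
    (hΔ : ∀ α ∈ Δ, α.IsClassical)
    (h : ∀ v, (∀ α ∈ Γ, α.CSat v) → ∃ α ∈ Δ, α.CSat v) : ∃ n, GT false n Γ Δ := by
  induction hn : (Γ.map Form.size).sum + (Δ.map Form.size).sum using Nat.strong_induction_on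
    generalizing Γ Δ with
  | _ n ih =>
  by_cases hl : ∃ α ∈ Γ, (∃ β, α = .neg β) ∨ (∃ β γ, α = .conj β γ) ∨ ∃ β γ, α = .disj β γ
  · obtain ⟨α, hα, hα'⟩ := hl
    obtain ⟨Γ, rfl⟩ := Multiset.exists_cons_of_mem hα
    rw [Multiset.forall_mem_cons] at hΓ
    simp only [Multiset.map_cons, Multiset.sum_cons] at hn
    obtain ⟨β, rfl⟩ | ⟨β, γ, rfl⟩ | ⟨β, γ, rfl⟩ := hα' <;>
      simp only [Form.size, Form.IsClassical, Multiset.forall_mem_cons, Form.CSat] at hn hΓ h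
    · obtain ⟨m, hm⟩ := ih _ (by simp only [Multiset.map_cons, Multiset.sum_cons]; omega)
        Γ (β ::ₘ Δ) hΓ.2 (Multiset.forall_mem_cons.2 ⟨hΓ.1, hΔ⟩)
        (fun v hv => by
          simp only [Multiset.mem_cons, exists_eq_or_imp]
          by_cases hβ : β.CSat v
          · exact Or.inl hβ
          · exact Or.inr (h v ⟨hβ, hv⟩)) rfl
      exact ⟨m + 1, .lneg _ _ _ _ _ hΓ.1 hm⟩
    · obtain ⟨m, hm⟩ := ih _ (by simp only [Multiset.map_cons, Multiset.sum_cons]; omega)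
        (β ::ₘ γ ::ₘ Γ) Δ (by simpa [and_assoc] using hΓ) hΔ
        (fun v hv => h v (by simpa [and_assoc] using hv)) rfl
      exact ⟨m + 1, .lconj _ _ _ _ _ _ hm⟩
    · obtain ⟨m, hm₁, hm₂⟩ := GT.exists_common_height
        (ih _ (by simp only [Multiset.map_cons, Multiset.sum_cons]; omega)
          (β ::ₘ Γ) Δ (Multiset.forall_mem_cons.2 ⟨hΓ.1.1, hΓ.2⟩) hΔ
          (fun v hv => h v ((Multiset.forall_mem_cons.1 hv).imp_left Or.inl)) rfl)
        (ih _ (by simp only [Multiset.map_cons, Multiset.sum_cons]; omega)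
          (γ ::ₘ Γ) Δ (Multiset.forall_mem_cons.2 ⟨hΓ.1.2, hΓ.2⟩) hΔ
          (fun v hv => h v ((Multiset.forall_mem_cons.1 hv).imp_left Or.inr)) rfl)
      exact ⟨m + 1, by simpa using GT.ldisj _ _ _ _ 0 _ _ hΔ hm₁ hm₂⟩
  by_cases hr : ∃ α ∈ Δ, (∃ β, α = .neg β) ∨ (∃ β γ, α = .conj β γ) ∨ ∃ β γ, α = .disj β γ
  · obtain ⟨α, hα, hα'⟩ := hr
    obtain ⟨Δ, rfl⟩ := Multiset.exists_cons_of_mem hα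
    rw [Multiset.forall_mem_cons] at hΔ
    simp only [Multiset.map_cons, Multiset.sum_cons] at hn
    obtain ⟨β, rfl⟩ | ⟨β, γ, rfl⟩ | ⟨β, γ, rfl⟩ := hα' <;>
      simp only [Form.size, Form.IsClassical, Multiset.mem_cons, exists_eq_or_imp, Form.CSat]
        at hn hΔ h
    · obtain ⟨m, hm⟩ := ih _ (by simp only [Multiset.map_cons, Multiset.sum_cons]; omega)
        (β ::ₘ Γ) Δ (Multiset.forall_mem_cons.2 ⟨hΔ.1, hΓ⟩) hΔ.2
        (fun v hv => by
          rw [Multiset.forall_mem_cons] at hv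
          exact (h v hv.2).resolve_left (not_not.2 hv.1)) rfl
      exact ⟨m + 1, .rneg _ _ _ _ _ hΔ.1 hm⟩
    · obtain ⟨m, hm₁, hm₂⟩ := GT.exists_common_height
        (ih _ (by simp only [Multiset.map_cons, Multiset.sum_cons]; omega)
          Γ (β ::ₘ Δ) hΓ (Multiset.forall_mem_cons.2 ⟨hΔ.1.1, hΔ.2⟩)
          (fun v hv => by simpa using (h v hv).imp_left And.left) rfl)
        (ih _ (by simp only [Multiset.map_cons, Multiset.sum_cons]; omega)
          Γ (γ ::ₘ Δ) hΓ (Multiset.forall_mem_cons.2 ⟨hΔ.1.2, hΔ.2⟩)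
          (fun v hv => by simpa using (h v hv).imp_left And.right) rfl)
      exact ⟨m + 1, by simpa using GT.rconj _ _ _ _ 0 _ _ hΔ.2 hm₁ hm₂⟩
    · obtain ⟨m, hm⟩ := ih _ (by simp only [Multiset.map_cons, Multiset.sum_cons]; omega)
        Γ (β ::ₘ γ ::ₘ Δ) hΓ (by simpa [and_assoc] using hΔ)
        (fun v hv => by simpa [or_assoc] using h v hv) rfl
      exact ⟨m + 1, .rdisj _ _ _ _ _ _ hm⟩
  push Not at hl hr
  by_cases hbot : Form.bot ∈ Γ
  · obtain ⟨Γ, rfl⟩ := Multiset.exists_cons_of_mem hbot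
    exact ⟨1, .lbot ..⟩
  classical
  obtain ⟨α, hα, hsat⟩ := h (fun p => decide (Form.var p ∈ Γ)) fun α hα => by
    rcases (hΓ α hα).cases with ⟨p, rfl⟩ | rfl | hα'
    · simpa [Form.CSat] using hα
    · exact absurd hα hbot
    · have := hl α hα
      grind
  rcases (hΔ α hα).cases with ⟨p, rfl⟩ | rfl | hα'
  · obtain ⟨Δ, rfl⟩ := Multiset.exists_cons_of_mem hα
    obtain ⟨Γ, rfl⟩ := Multiset.exists_cons_of_mem (of_decide_eq_true hsat)
    exact ⟨1, .ax ..⟩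
  · exact hsat.elim
  · have := hr α hα
    grind

theorem GT.complete_of_classical_left {Γ Δ : Multiset Form} (hΓ : ∀ α ∈ Γ, α.IsClassical)
    (hΔ : ∀ φ ∈ Δ, φ.WF) (h : Valid Γ Δ) : ∃ n, GT false n Γ Δ := by
  revert h
  refine wf_multiset_induction (P := fun Δ => Valid Γ Δ → ∃ n, GT false n Γ Δ)
    (fun Δ hΔ h => ?_) (fun Δ χ a b ih₁ ih₂ h => ?_) Δ hΔ
  · exact GT.complete_of_classical Γ Δ hΓ hΔ ((valid_iff_of_classical hΓ hΔ).1 h)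
  · rcases (Valid.ridisj_iff hΓ).1 h with h | h
    · obtain ⟨n, hn⟩ := ih₁ h
      exact ⟨n + 1, .ridisjL _ _ _ _ _ _ _ hn⟩
    · obtain ⟨n, hn⟩ := ih₂ h
      exact ⟨n + 1, .ridisjR _ _ _ _ _ _ _ hn⟩

theorem GT.complete {Γ Δ : Multiset Form} (hΓ : ∀ φ ∈ Γ, φ.WF) (hΔ : ∀ φ ∈ Δ, φ.WF)
    (h : Valid Γ Δ) : ∃ n, GT false n Γ Δ := by
  revert h
  refine wf_multiset_induction (P := fun Γ => Valid Γ Δ → ∃ n, GT false n Γ Δ)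
    (fun Γ hΓ h => GT.complete_of_classical_left hΓ hΔ h) (fun Γ χ a b ih₁ ih₂ h => ?_) Γ hΓ
  obtain ⟨h₁, h₂⟩ := Valid.lidisj_iff.1 h
  obtain ⟨n, hn₁, hn₂⟩ := GT.exists_common_height (ih₁ h₁) (ih₂ h₂)
  exact ⟨n + 1, .lidisj _ _ _ _ _ _ _ hn₁ hn₂⟩

/-! ### Lyndon interpolation for classical formulas -/

/-- `SignedLE C v u`: passing from `v` to `u` switches no variable of `C true` off and no variable
of `C false` on. -/
def SignedLE (C : Bool → Set ℕ) (v u : Val) : Prop :=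
  (∀ p ∈ C true, v p = true → u p = true) ∧ ∀ p ∈ C false, u p = true → v p = true

theorem Form.CSat.mono {α : Form} {v u : Val} (h : α.CSat v) (hvu : SignedLE α.svars v u) :
    α.CSat u := by
  suffices H : ∀ v u, SignedLE α.svars v u → α.CSat v → α.CSat u from H v u hvu h
  clear h hvu v u
  induction α with
  | var p => exact fun v u h => h.1 p (by simp [svars])
  | bot => exact fun _ _ _ h => h
  | neg α ih => exact fun v u hvu hv hu => hv (ih u v ⟨hvu.2, hvu.1⟩ hu)
  | conj α β ih₁ ih₂ =>
    exact fun v u hvu => And.imp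
      (ih₁ v u ⟨fun p hp => hvu.1 p (Or.inl hp), fun p hp => hvu.2 p (Or.inl hp)⟩)
      (ih₂ v u ⟨fun p hp => hvu.1 p (Or.inr hp), fun p hp => hvu.2 p (Or.inr hp)⟩)
  | disj α β ih₁ ih₂ =>
    exact fun v u hvu => Or.imp
      (ih₁ v u ⟨fun p hp => hvu.1 p (Or.inl hp), fun p hp => hvu.2 p (Or.inl hp)⟩)
      (ih₂ v u ⟨fun p hp => hvu.1 p (Or.inr hp), fun p hp => hvu.2 p (Or.inr hp)⟩)
  | idisj α β _ _ => exact fun _ _ _ h => h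

/-- A set of valuations defined by a classical formula whose signed variables lie in `C`. -/
def Definable (C : Bool → Set ℕ) (Z : Set Val) : Prop :=
  ∃ α : Form, α.IsClassical ∧ (∀ b, α.svars b ⊆ C b) ∧ ∀ v, α.CSat v ↔ v ∈ Z

namespace Definable

variable {C : Bool → Set ℕ} {Z W : Set Val}

theorem empty : Definable C ∅ :=
  ⟨.bot, trivial, fun _ => Set.empty_subset _, fun _ => Iff.rfl⟩

theorem univ : Definable C Set.univ :=
  ⟨.neg .bot, trivial, fun _ => Set.empty_subset _, fun _ => iff_of_true id trivial⟩

theorem union (hZ : Definable C Z) (hW : Definable C W) : Definable C (Z ∪ W) := by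
  obtain ⟨α, hα, hαC, hαZ⟩ := hZ
  obtain ⟨β, hβ, hβC, hβW⟩ := hW
  exact ⟨.disj α β, ⟨hα, hβ⟩, fun b => Set.union_subset (hαC b) (hβC b),
    fun v => or_congr (hαZ v) (hβW v)⟩

theorem inter (hZ : Definable C Z) (hW : Definable C W) : Definable C (Z ∩ W) := by
  obtain ⟨α, hα, hαC, hαZ⟩ := hZ
  obtain ⟨β, hβ, hβC, hβW⟩ := hW
  exact ⟨.conj α β, ⟨hα, hβ⟩, fun b => Set.union_subset (hαC b) (hβC b),
    fun v => and_congr (hαZ v) (hβW v)⟩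

theorem sUnion {F : Set (Set Val)} (hF : F.Finite) (h : ∀ Z ∈ F, Definable C Z) :
    Definable C (⋃₀ F) := by
  induction F, hF using Set.Finite.induction_on with
  | empty => simpa using empty
  | insert _ _ ih =>
    rw [Set.sUnion_insert]
    exact (h _ (Set.mem_insert _ _)).union (ih fun Z hZ => h Z (Set.mem_insert_of_mem _ hZ))

theorem biInter {S : Set ℕ} (hS : S.Finite) {f : ℕ → Set Val} (h : ∀ p ∈ S, Definable C (f p)) :
    Definable C (⋂ p ∈ S, f p) := by
  induction S, hS using Set.Finite.induction_on with
  | empty => simpa using univ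
  | insert _ _ ih =>
    rw [Set.biInter_insert]
    exact (h _ (Set.mem_insert _ _)).inter (ih fun p hp => h p (Set.mem_insert_of_mem _ hp))

theorem var {p : ℕ} (hp : p ∈ C true) : Definable C {v | v p = true} :=
  ⟨.var p, trivial, by rintro (_ | _) <;> simp [Form.svars, hp], fun _ => Iff.rfl⟩

theorem neg_var {p : ℕ} (hp : p ∈ C false) : Definable C {v | ¬ v p = true} :=
  ⟨.neg (.var p), trivial, by rintro (_ | _) <;> simp [Form.svars, hp], fun _ => Iff.rfl⟩

theorem literals {S T : Set ℕ} (hS : S.Finite) (hT : T.Finite) (hSC : S ⊆ C true)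
    (hTC : T ⊆ C false) :
    Definable C ((⋂ p ∈ S, {v | v p = true}) ∩ ⋂ p ∈ T, {v | ¬ v p = true}) :=
  (biInter hS fun _ hp => var (hSC hp)).inter (biInter hT fun _ hp => neg_var (hTC hp))

theorem upperClosure (hC : ∀ b, (C b).Finite) (X : Set Val) :
    Definable C {u | ∃ v ∈ X, SignedLE C v u} := by
  let g : Set ℕ × Set ℕ → Set Val :=
    fun S => (⋂ p ∈ S.1, {v | v p = true}) ∩ ⋂ p ∈ S.2, {v | ¬ v p = true}
  let k : Val → Set ℕ × Set ℕ :=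
    fun v => ({p ∈ C true | v p = true}, {p ∈ C false | ¬ v p = true})
  have hk : ∀ v, (k v).1 ⊆ C true ∧ (k v).2 ⊆ C false := fun v =>
    ⟨Set.sep_subset _ _, Set.sep_subset _ _⟩
  have hfin : (k '' X).Finite := by
    refine ((hC true).finite_subsets.prod (hC false).finite_subsets).subset ?_
    rintro _ ⟨v, -, rfl⟩
    exact hk v
  have heq : {u | ∃ v ∈ X, SignedLE C v u} = ⋃₀ (g '' (k '' X)) := by
    ext u
    simp only [Set.mem_ofPred_eq, Set.sUnion_image, Set.biUnion_image, Set.mem_iUnion, exists_prop]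
    refine exists_congr fun v => and_congr_right fun _ => ?_
    simp only [g, k, SignedLE, Set.mem_inter_iff, Set.mem_iInter, Set.mem_ofPred_eq, and_imp]
    refine and_congr Iff.rfl (forall₂_congr fun p _ => ?_)
    tauto
  rw [heq]
  refine sUnion (hfin.image g) ?_
  rintro _ ⟨_, ⟨v, -, rfl⟩, rfl⟩
  exact literals ((hC true).subset (hk v).1) ((hC false).subset (hk v).2) (hk v).1 (hk v).2

end Definable

/-- Semantic form of Lyndon interpolation. -/
theorem exists_definable_between {A B : Bool → Set ℕ} (hA : ∀ b, (A b).Finite) {X Y : Set Val}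
    (hX : ∀ v ∈ X, ∀ u, SignedLE A v u → u ∈ X) (hY : ∀ v ∈ Y, ∀ u, SignedLE B v u → u ∈ Y)
    (hXY : X ⊆ Y) : ∃ Z, Definable (fun b => A b ∩ B b) Z ∧ X ⊆ Z ∧ Z ⊆ Y := by
  classical
  refine ⟨_, Definable.upperClosure (fun b => (hA b).inter_of_left (B b)) X,
    fun v hv => ⟨v, hv, fun _ _ => id, fun _ _ => id⟩, ?_⟩
  rintro w ⟨v, hv, hvw⟩
  let u : Val := fun p => decide ((p ∈ A true ∧ v p = true) ∨ (p ∈ B false ∧ w p = true))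
  have hvu : SignedLE A v u := by
    refine ⟨fun p hp h => by simp [u, hp, h], fun p hp h => ?_⟩
    rcases of_decide_eq_true h with h | h
    exacts [h.2, hvw.2 p ⟨hp, h.1⟩ h.2]
  have huw : SignedLE B u w := by
    refine ⟨fun p hp h => ?_, fun p hp h => by simp [u, hp, h]⟩
    rcases of_decide_eq_true h with h | h
    exacts [hvw.1 p ⟨h.1, hp⟩ h.2, h.2]
  exact hY u (hXY (hX v hv u hvu)) w huw

/-! ### Interpolation for valid sequents -/

/-- Variables with an occurrence of sign `b` in a member of `Γ`. -/
def msvars (Γ : Multiset Form) (b : Bool) : Set ℕ := {p | ∃ φ ∈ Γ, p ∈ φ.svars b}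

theorem finite_msvars (Γ : Multiset Form) (b : Bool) : (msvars Γ b).Finite := by
  classical
  have : msvars Γ b = ⋃ φ ∈ (Γ.toFinset : Set Form), φ.svars b := by
    ext p
    simp [msvars]
  rw [this]
  exact Γ.toFinset.finite_toSet.biUnion fun φ _ => φ.finite_svars b

theorem msvars_cons_fill_subset (Γ : Multiset Form) (χ : Ctx) {a c : Form} {b : Bool}
    (h : a.svars b ⊆ c.svars b) : msvars (χ.fill a ::ₘ Γ) b ⊆ msvars (χ.fill c ::ₘ Γ) b := by
  rintro p ⟨φ, hφ, hp⟩
  rcases Multiset.mem_cons.1 hφ with rfl | hφ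
  · exact ⟨_, Multiset.mem_cons_self _ _, χ.svars_fill_subset h hp⟩
  · exact ⟨φ, Multiset.mem_cons_of_mem hφ, hp⟩

/-- `φ` interpolates the sequent `Γ₁, Γ₂ ⇒ Λ₁, Δ₂` semantically. -/
structure IsInterpolant (Γ₁ Γ₂ Λ₁ Δ₂ : Multiset Form) (φ : Form) : Prop where
  wf : φ.WF
  left : Valid Γ₁ (φ ::ₘ Λ₁)
  right : Valid (φ ::ₘ Γ₂) Δ₂
  svars_subset_left : ∀ b, φ.svars b ⊆ msvars Γ₁ b ∪ msvars Λ₁ (!b)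
  svars_subset_right : ∀ b, φ.svars b ⊆ msvars Γ₂ (!b) ∪ msvars Δ₂ b
  classical : (∀ α ∈ Δ₂, α.IsClassical) → φ.IsClassical

section Interpolation

variable {Γ₁ Γ₂ Λ₁ Δ₂ : Multiset Form}

theorem exists_interpolant_of_classical (hΓ₁ : ∀ α ∈ Γ₁, α.IsClassical)
    (hΓ₂ : ∀ α ∈ Γ₂, α.IsClassical) (hΛ₁ : ∀ α ∈ Λ₁, α.IsClassical)
    (hΔ₂ : ∀ α ∈ Δ₂, α.IsClassical) (h : Valid (Γ₁ + Γ₂) (Λ₁ + Δ₂)) :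
    ∃ φ, IsInterpolant Γ₁ Γ₂ Λ₁ Δ₂ φ := by
  rw [valid_iff_of_classical (by simpa [or_imp, forall_and] using ⟨hΓ₁, hΓ₂⟩)
    (by simpa [or_imp, forall_and] using ⟨hΛ₁, hΔ₂⟩)] at h
  obtain ⟨Z, ⟨φ, hφ, hφv, hφZ⟩, hXZ, hZY⟩ := exists_definable_between
    (A := fun b => msvars Γ₁ b ∪ msvars Λ₁ (!b)) (B := fun b => msvars Γ₂ (!b) ∪ msvars Δ₂ b)
    (X := {v | (∀ α ∈ Γ₁, α.CSat v) ∧ ∀ α ∈ Λ₁, ¬ α.CSat v})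
    (Y := {v | (∀ α ∈ Γ₂, α.CSat v) → ∃ α ∈ Δ₂, α.CSat v})
    (fun b => (finite_msvars Γ₁ b).union (finite_msvars Λ₁ !b))
    (fun v hv u hvu =>
      ⟨fun α hα => (hv.1 α hα).mono
        ⟨fun p hp => hvu.1 p (Or.inl ⟨α, hα, hp⟩), fun p hp => hvu.2 p (Or.inl ⟨α, hα, hp⟩)⟩,
       fun α hα hu => hv.2 α hα (hu.mono
        ⟨fun p hp => hvu.2 p (Or.inr ⟨α, hα, hp⟩), fun p hp => hvu.1 p (Or.inr ⟨α, hα, hp⟩)⟩)⟩)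
    (fun v hv u hvu hu => by
      obtain ⟨α, hα, hαv⟩ := hv fun α hα => (hu α hα).mono
        ⟨fun p hp => hvu.2 p (Or.inl ⟨α, hα, hp⟩), fun p hp => hvu.1 p (Or.inl ⟨α, hα, hp⟩)⟩
      exact ⟨α, hα, hαv.mono
        ⟨fun p hp => hvu.1 p (Or.inr ⟨α, hα, hp⟩), fun p hp => hvu.2 p (Or.inr ⟨α, hα, hp⟩)⟩⟩)
    (fun v hv hv₂ => by
      obtain ⟨α, hα, hαv⟩ := h v fun α hα =>
        (Multiset.mem_add.1 hα).elim (hv.1 α) (hv₂ α)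
      exact (Multiset.mem_add.1 hα).elim (fun hα => (hv.2 α hα hαv).elim)
        fun hα => ⟨α, hα, hαv⟩)
  refine ⟨φ, hφ.wf, ?_, ?_, fun b => (hφv b).trans Set.inter_subset_left,
    fun b => (hφv b).trans Set.inter_subset_right, fun _ => hφ⟩
  · rw [valid_iff_of_classical hΓ₁ (Multiset.forall_mem_cons.2 ⟨hφ, hΛ₁⟩)]
    intro v hv
    simp only [Multiset.mem_cons, exists_eq_or_imp]
    by_contra! hcon
    exact hcon.1 ((hφZ v).2 (hXZ ⟨hv, hcon.2⟩))
  · rw [valid_iff_of_classical (Multiset.forall_mem_cons.2 ⟨hφ, hΓ₂⟩) hΔ₂]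
    intro v hv
    rw [Multiset.forall_mem_cons] at hv
    exact hZY ((hφZ v).1 hv.1) hv.2

theorem exists_interpolant_of_classical_left (hΓ₁ : ∀ α ∈ Γ₁, α.IsClassical)
    (hΓ₂ : ∀ α ∈ Γ₂, α.IsClassical) (hΛ₁ : ∀ α ∈ Λ₁, α.IsClassical) (hΔ₂ : ∀ φ ∈ Δ₂, φ.WF)
    (h : Valid (Γ₁ + Γ₂) (Λ₁ + Δ₂)) : ∃ φ, IsInterpolant Γ₁ Γ₂ Λ₁ Δ₂ φ := by
  revert h
  refine wf_multiset_induction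
    (P := fun Δ₂ => Valid (Γ₁ + Γ₂) (Λ₁ + Δ₂) → ∃ φ, IsInterpolant Γ₁ Γ₂ Λ₁ Δ₂ φ)
    (fun Δ₂ hΔ₂ h => exists_interpolant_of_classical hΓ₁ hΓ₂ hΛ₁ hΔ₂ h)
    (fun Δ χ a b ih₁ ih₂ h => ?_) Δ₂ hΔ₂
  have key : ∀ c : Form, (∀ t, c.Sat t → (Form.idisj a b).Sat t) →
      (∀ i, c.svars i ⊆ (Form.idisj a b).svars i) →
      (∃ φ, IsInterpolant Γ₁ Γ₂ Λ₁ (χ.fill c ::ₘ Δ) φ) →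
      ∃ φ, IsInterpolant Γ₁ Γ₂ Λ₁ (χ.fill (.idisj a b) ::ₘ Δ) φ := by
    rintro c hc hcv ⟨φ, hφ⟩
    refine ⟨φ, hφ.wf, hφ.left, hφ.right.head_right fun t => χ.sat_fill_mono hc,
      hφ.svars_subset_left, fun i => (hφ.svars_subset_right i).trans
        (Set.union_subset_union_right _ (msvars_cons_fill_subset Δ χ (hcv i))), fun hcl => ?_⟩
    exact (χ.not_isClassical_fill_idisj (hcl _ (Multiset.mem_cons_self _ _))).elim
  rw [Multiset.add_cons] at h
  rcases (Valid.ridisj_iff (by simpa [or_imp, forall_and] using ⟨hΓ₁, hΓ₂⟩)).1 h with h | h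
  · rw [← Multiset.add_cons] at h
    exact key a (fun _ => Or.inl) (fun _ => Set.subset_union_left) (ih₁ h)
  · rw [← Multiset.add_cons] at h
    exact key b (fun _ => Or.inr) (fun _ => Set.subset_union_right) (ih₂ h)

theorem exists_interpolant_of_classical_fst (hΓ₁ : ∀ α ∈ Γ₁, α.IsClassical)
    (hΓ₂ : ∀ φ ∈ Γ₂, φ.WF) (hΛ₁ : ∀ α ∈ Λ₁, α.IsClassical) (hΔ₂ : ∀ φ ∈ Δ₂, φ.WF)
    (h : Valid (Γ₁ + Γ₂) (Λ₁ + Δ₂)) : ∃ φ, IsInterpolant Γ₁ Γ₂ Λ₁ Δ₂ φ := by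
  revert h
  refine wf_multiset_induction
    (P := fun Γ₂ => Valid (Γ₁ + Γ₂) (Λ₁ + Δ₂) → ∃ φ, IsInterpolant Γ₁ Γ₂ Λ₁ Δ₂ φ)
    (fun Γ₂ hΓ₂ h => exists_interpolant_of_classical_left hΓ₁ hΓ₂ hΛ₁ hΔ₂ h)
    (fun Γ χ a b ih₁ ih₂ h => ?_) Γ₂ hΓ₂
  rw [Multiset.add_cons, Valid.lidisj_iff, ← Multiset.add_cons, ← Multiset.add_cons] at h
  obtain ⟨φ, hφ⟩ := ih₁ h.1
  obtain ⟨ψ, hψ⟩ := ih₂ h.2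
  refine ⟨.conj φ ψ, ⟨hφ.wf, hψ.wf⟩, Valid.rconj hΛ₁ hφ.left hψ.left, ?_,
    fun i => Set.union_subset (hφ.svars_subset_left i) (hψ.svars_subset_left i),
    fun i => Set.union_subset ((hφ.svars_subset_right i).trans ?_)
      ((hψ.svars_subset_right i).trans ?_),
    fun hcl => ⟨hφ.classical hcl, hψ.classical hcl⟩⟩
  · rw [Multiset.cons_swap, Valid.lidisj_iff]
    constructor
    · rw [Multiset.cons_swap]
      exact hφ.right.head_left fun _ => And.left
    · rw [Multiset.cons_swap]
      exact hψ.right.head_left fun _ => And.right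
  · exact Set.union_subset_union_left _
      (msvars_cons_fill_subset Γ χ Set.subset_union_left)
  · exact Set.union_subset_union_left _
      (msvars_cons_fill_subset Γ χ Set.subset_union_right)

theorem Valid.exists_interpolant (hΓ₁ : ∀ φ ∈ Γ₁, φ.WF)
    (hΓ₂ : ∀ φ ∈ Γ₂, φ.WF) (hΛ₁ : ∀ α ∈ Λ₁, α.IsClassical) (hΔ₂ : ∀ φ ∈ Δ₂, φ.WF)
    (h : Valid (Γ₁ + Γ₂) (Λ₁ + Δ₂)) : ∃ φ, IsInterpolant Γ₁ Γ₂ Λ₁ Δ₂ φ := by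
  revert h
  refine wf_multiset_induction
    (P := fun Γ₁ => Valid (Γ₁ + Γ₂) (Λ₁ + Δ₂) → ∃ φ, IsInterpolant Γ₁ Γ₂ Λ₁ Δ₂ φ)
    (fun Γ₁ hΓ₁ h => exists_interpolant_of_classical_fst hΓ₁ hΓ₂ hΛ₁ hΔ₂ h)
    (fun Γ χ a b ih₁ ih₂ h => ?_) Γ₁ hΓ₁
  rw [Multiset.cons_add, Valid.lidisj_iff, ← Multiset.cons_add, ← Multiset.cons_add] at h
  obtain ⟨φ, hφ⟩ := ih₁ h.1
  obtain ⟨ψ, hψ⟩ := ih₂ h.2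
  have hleft : ∀ i, φ.svars i ∪ ψ.svars i ⊆
      msvars (χ.fill (.idisj a b) ::ₘ Γ) i ∪ msvars Λ₁ (!i) := fun i =>
    Set.union_subset
      ((hφ.svars_subset_left i).trans (Set.union_subset_union_left _
        (msvars_cons_fill_subset Γ χ Set.subset_union_left)))
      ((hψ.svars_subset_left i).trans (Set.union_subset_union_left _
        (msvars_cons_fill_subset Γ χ Set.subset_union_right)))
  have hright : ∀ i, φ.svars i ∪ ψ.svars i ⊆ msvars Γ₂ (!i) ∪ msvars Δ₂ i := fun i =>
    Set.union_subset (hφ.svars_subset_right i) (hψ.svars_subset_right i)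
  by_cases hcl : ∀ α ∈ Δ₂, α.IsClassical
  · refine ⟨.disj φ ψ, ⟨hφ.wf, hψ.wf⟩, Valid.lidisj_iff.2 ⟨?_, ?_⟩,
      Valid.ldisj hcl hφ.right hψ.right, hleft, hright,
      fun hcl => ⟨hφ.classical hcl, hψ.classical hcl⟩⟩
    · exact hφ.left.head_right fun t ht => ⟨t, ∅, by simp, ht, ψ.sat_empty⟩
    · exact hψ.left.head_right fun t ht => ⟨∅, t, by simp, φ.sat_empty, ht⟩
  · refine ⟨.idisj φ ψ, ⟨hφ.wf, hψ.wf⟩, Valid.lidisj_iff.2 ⟨?_, ?_⟩,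
      (Valid.lidisj_iff (χ := .hole)).2 ⟨hφ.right, hψ.right⟩, hleft, hright,
      fun h => (hcl h).elim⟩
    · exact hφ.left.head_right fun _ => Or.inl
    · exact hψ.left.head_right fun _ => Or.inr

end Interpolation

/-- Sequent interpolation: if Γ₁,Γ₂ ⇒ Λ₁,Δ₂ is derivable in
GT with Λ₁ classical, then there is a sequent interpolant φ, classical
whenever Δ₂ is classical. -/
theorem sequent_interpolation (Γ₁ Γ₂ Λ₁ Δ₂ : Multiset Form)
    (hΓ₁ : ∀ φ ∈ Γ₁, Form.WF φ) (hΓ₂ : ∀ φ ∈ Γ₂, Form.WF φ)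
    (hΛ₁ : ∀ α ∈ Λ₁, Form.IsClassical α) (hΔ₂ : ∀ φ ∈ Δ₂, Form.WF φ)
    (h : ∃ n, GT true n (Γ₁ + Γ₂) (Λ₁ + Δ₂)) :
    ∃ φ : Form, φ.WF ∧
      (∃ n, GT false n Γ₁ (φ ::ₘ Λ₁)) ∧
      (∃ n, GT false n (φ ::ₘ Γ₂) Δ₂) ∧
      Form.pvars φ ⊆ (mpvars Γ₁ ∪ mnvars Λ₁) ∩ (mnvars Γ₂ ∪ mpvars Δ₂) ∧
      Form.nvars φ ⊆ (mnvars Γ₁ ∪ mpvars Λ₁) ∩ (mpvars Γ₂ ∪ mnvars Δ₂) ∧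
      ((∀ α ∈ Δ₂, Form.IsClassical α) → φ.IsClassical) := by
  obtain ⟨n, h⟩ := h
  obtain ⟨φ, hφ⟩ := h.sound.exists_interpolant hΓ₁ hΓ₂ hΛ₁ hΔ₂
  exact ⟨φ, hφ.wf,
    GT.complete hΓ₁ (Multiset.forall_mem_cons.2 ⟨hφ.wf, fun α hα => (hΛ₁ α hα).wf⟩) hφ.left,
    GT.complete (Multiset.forall_mem_cons.2 ⟨hφ.wf, hΓ₂⟩) hΔ₂ hφ.right,
    Set.subset_inter (hφ.svars_subset_left true) (hφ.svars_subset_right true),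
    Set.subset_inter (hφ.svars_subset_left false) (hφ.svars_subset_right false), hφ.classical⟩
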